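/- arXiv:1604.02606 — 7 statements merged into one kernel-verified Lean document; each statement's English description precedes it below -/
import Mathlib

section
/- Suppose β̄ is a global minimizer of the retrained empirical risk L_R (i.e., L_R(β̄) ≤ L_R(β) for all β ∈ B), and the RAD termination condition holds at β̄: for every malicious index i ∈ I⁺, O β̄ (x i) ∈ insert (x i) (N i). Then for every β ∈ B, L_A(β̄) ≤ L_R(β); in particular, the infimum over all β of the adversarial risk L_A(β) is at most L_R(β) for every β. -/
/-- If `β̄` globally minimizes the retrained empirical risk `LR` and the
RAD termination condition holds at `β̄`, then `LA β̄ ≤ LR β` for every `β`; in particular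
the infimum of the adversarial risk is at most `LR β` for every `β`. -/
theorem retraining_upper_bounds_adversarial_risk
    {B X I : Type*} [Fintype I] [DecidableEq I] [DecidableEq X]
    (x : I → X) (Iminus Iplus : Finset I)
    (hpart : Iminus ∪ Iplus = Finset.univ) (hdisj : Disjoint Iminus Iplus)
    (ℓneg ℓpos : B → X → ℝ)
    (hℓneg : ∀ β z, 0 ≤ ℓneg β z) (hℓpos : ∀ β z, 0 ≤ ℓpos β z)
    (r : B → ℝ) (hr : ∀ β, 0 ≤ r β)
    (O : B → X → X) (N : I → Finset X)
    (LA LR : B → ℝ)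
    (hLA : ∀ β, LA β =
      (∑ i ∈ Iminus, ℓneg β (x i)) + (∑ i ∈ Iplus, ℓpos β (O β (x i))) + r β)
    (hLR : ∀ β, LR β =
      (∑ i ∈ Iminus, ℓneg β (x i)) +
        (∑ i ∈ Iplus, ∑ x' ∈ insert (x i) (N i), ℓpos β x') + r β)
    (βbar : B)
    (hmin : ∀ β, LR βbar ≤ LR β)
    (hterm : ∀ i ∈ Iplus, O βbar (x i) ∈ insert (x i) (N i)) :
    (∀ β, LA βbar ≤ LR β) ∧ (∀ β, (⨅ β' : B, LA β') ≤ LR β) := by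
  have hbar : ∀ β, LA βbar ≤ LR β := fun β => by
    refine le_trans ?_ (hmin β)
    rw [hLA, hLR]
    gcongr with i hi
    exact Finset.single_le_sum (f := ℓpos βbar) (fun z _ => hℓpos βbar z) (hterm i hi)
  have hbdd : BddBelow (Set.range LA) := by
    refine ⟨0, ?_⟩
    rintro _ ⟨β, rfl⟩
    rw [hLA]
    exact add_nonneg (add_nonneg (Finset.sum_nonneg fun i _ => hℓneg β (x i))
      (Finset.sum_nonneg fun i _ => hℓpos β _)) (hr β)
  exact ⟨hbar, fun β => (ciInf_le hbdd βbar).trans (hbar β)⟩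
end

section
/- Suppose x* ∈ X is a global minimizer of Φ (i.e., Φ(x*) ≤ Φ(x) for all x ∈ X), that f x* < 0, and that xᵢ is suboptimal for Φ (i.e., Φ(x*) < Φ(xᵢ)). Let x̄ ∈ X be a global minimizer of Q (i.e., Q(x̄) ≤ Q(x) for all x ∈ X). Then f x̄ + c x̄ = f x* + c x* (that is, Q(x̄) = Q(x*)), and f x̄ < 0. -/
/-- Lemma 4.1: if `x*` globally minimizes `Φ`, `f x* < 0`, and `xᵢ` is
suboptimal for `Φ`, then any global minimizer `x̄` of `Q` satisfies
`f x̄ + c x̄ = f x* + c x*` and `f x̄ < 0`. -/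
theorem relaxed_attack_matches_optimal
    {X : Type*} (f c : X → ℝ) (xi : X)
    (hc : ∀ x, 0 ≤ c x) (hcxi : c xi = 0)
    (Φ Q : X → ℝ)
    (hΦ : ∀ x, Φ x = min 0 (f x) + c x)
    (hQ : ∀ x, Q x = f x + c x)
    (xstar : X) (hstar : ∀ x, Φ xstar ≤ Φ x)
    (hfstar : f xstar < 0)
    (hsub : Φ xstar < Φ xi)
    (xbar : X) (hbar : ∀ x, Q xbar ≤ Q x) :
    f xbar + c xbar = f xstar + c xstar ∧ f xbar < 0 := by
  have hΦstar : Φ xstar = f xstar + c xstar := by rw [hΦ, min_eq_right hfstar.le]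
  have hle : Φ xstar ≤ f xbar + c xbar := by
    have h := hstar xbar
    rw [hΦ xbar] at h
    linarith [min_le_right 0 (f xbar)]
  have hge : f xbar + c xbar ≤ f xstar + c xstar := by
    simpa only [hQ] using hbar xstar
  have hneg : Φ xstar < 0 := by
    rw [hΦ xi, hcxi, add_zero] at hsub
    exact hsub.trans_le (min_le_left _ _)
  exact ⟨by linarith, by linarith [hc xbar]⟩
end

section
/- Let E be a real vector space, let f : E → ℝ be convex on all of E (ConvexOn ℝ Set.univ f), and let c : E → ℝ be strictly convex on all of E (StrictConvexOn ℝ Set.univ c) with c x ≥ 0 for all x and c xᵢ = 0. Suppose x* is a global minimizer of Φ with f x* < 0, that xᵢ is suboptimal for Φ (i.e., Φ(x*) < Φ(xᵢ)), and that x̄ is a global minimizer of Q. Then x̄ = x*. -/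
/-- Corollary 4.2: with `f` convex and `c` strictly convex (nonnegative,
vanishing at `xᵢ`), if `x*` globally minimizes `Φ` with `f x* < 0`, `xᵢ` is suboptimal
for `Φ`, and `x̄` globally minimizes `Q`, then `x̄ = x*`. -/
theorem relaxed_attack_unique_optimum
    {E : Type*} [AddCommGroup E] [Module ℝ E]
    (f c : E → ℝ)
    (hf : ConvexOn ℝ Set.univ f) (hc : StrictConvexOn ℝ Set.univ c)
    (xi : E) (hcnn : ∀ x, 0 ≤ c x) (hcxi : c xi = 0)
    (Φ Q : E → ℝ)
    (hΦ : ∀ x, Φ x = min 0 (f x) + c x)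
    (hQ : ∀ x, Q x = f x + c x)
    (xstar : E) (hstar : ∀ x, Φ xstar ≤ Φ x)
    (hfstar : f xstar < 0)
    (hsub : Φ xstar < Φ xi)
    (xbar : E) (hbar : ∀ x, Q xbar ≤ Q x) :
    xbar = xstar := by
  have hQconv : StrictConvexOn ℝ Set.univ Q := by
    rw [funext hQ]
    exact hf.add_strictConvexOn hc
  have hΦQ : ∀ x, Φ x ≤ Q x := fun x => by
    rw [hΦ, hQ]
    gcongr
    exact min_le_right _ _
  have hstarQ : Q xstar = Φ xstar := by
    rw [hΦ, hQ, min_eq_right hfstar.le]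
  have hstar_min : ∀ x, Q xstar ≤ Q x := fun x =>
    hstarQ.le.trans ((hstar x).trans (hΦQ x))
  exact hQconv.eq_of_isMinOn (fun x _ => hbar x) (fun x _ => hstar_min x)
    (Set.mem_univ _) (Set.mem_univ _)
end

section
/- Suppose x* ∈ X is a global minimizer of Φ with f x* < 0, and that xᵢ is suboptimal for Φ (i.e., Φ(x*) < Φ(xᵢ)). If Q attains a global minimum at some point x̄ ∈ X, then x* is also a global minimizer of Q: Q(x*) ≤ Q(x) for all x ∈ X. -/
/-- if `x*` globally minimizes `Φ` with `f x* < 0` and `xᵢ` is suboptimal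
for `Φ`, and `Q` attains a global minimum somewhere, then `x*` globally minimizes `Q`. -/
theorem optimal_attack_minimizes_relaxation
    {X : Type*} (f c : X → ℝ) (xi : X)
    (hc : ∀ x, 0 ≤ c x) (hcxi : c xi = 0)
    (Φ Q : X → ℝ)
    (hΦ : ∀ x, Φ x = min 0 (f x) + c x)
    (hQ : ∀ x, Q x = f x + c x)
    (xstar : X) (hstar : ∀ x, Φ xstar ≤ Φ x)
    (hfstar : f xstar < 0)
    (hsub : Φ xstar < Φ xi)
    (xbar : X) (hbar : ∀ x, Q xbar ≤ Q x) :
    ∀ x, Q xstar ≤ Q x := by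
  intro x
  calc Q xstar = Φ xstar := by rw [hQ, hΦ, min_eq_right hfstar.le]
    _ ≤ Φ x := hstar x
    _ ≤ Q x := by
      rw [hΦ, hQ]
      gcongr
      exact min_le_right _ _
end

section
/- Let (Ω, μ) be a probability space, B a positive natural number, and p_L ∈ [0,1]. Let a, b : Fin B → Ω → ℝ take values in {0,1} pointwise, and let E : Fin B → Set Ω be measurable events that are independent (as a family with respect to μ) with μ (E k) ≤ p_L for each k, such that for every k and every ω ∉ E k, a k ω ≤ b k ω. Then for every p ∈ (0,1), μ {ω : Σ_k a k ω ≤ Σ_k b k ω + δ(p)} ≥ 1 − p, where δ(p) = B·p_L + (Real.sqrt ((Real.log p)^2 − 8·B·p_L·(Real.log p)) − Real.log p) / 2. -/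
open MeasureTheory ProbabilityTheory

/-- The moment generating function of an indicator is at most that of a Poisson variable. -/
lemma mgf_indicator_one_le {Ω : Type*} [MeasurableSpace Ω] {μ : Measure Ω}
    [IsProbabilityMeasure μ] {A : Set Ω} (hA : MeasurableSet A) {q s : ℝ}
    (hAq : μ.real A ≤ q) (hs : 0 ≤ s) :
    mgf (A.indicator fun _ => (1 : ℝ)) μ s ≤ Real.exp (q * (Real.exp s - 1)) := by
  have hfun : (fun ω => Real.exp (s * A.indicator (fun _ => (1 : ℝ)) ω)) =
      fun ω => 1 + A.indicator (fun _ => Real.exp s - 1) ω := by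
    ext ω
    by_cases h : ω ∈ A <;> simp [h]
  have hexp : 0 ≤ Real.exp s - 1 := by linarith [Real.one_le_exp hs]
  have hmgf : mgf (A.indicator fun _ => (1 : ℝ)) μ s = 1 + μ.real A * (Real.exp s - 1) := by
    rw [mgf, hfun, integral_add (integrable_const _) ((integrable_const _).indicator hA),
      integral_indicator_const _ hA]
    simp
  rw [hmgf]
  have := mul_le_mul_of_nonneg_right hAq hexp
  linarith [Real.add_one_le_exp (q * (Real.exp s - 1))]

/-- **Multiplicative Chernoff bound** for the number of independent events that occur. -/
lemma measureReal_sum_indicator_ge_le {Ω ι : Type*} [Fintype ι] [MeasurableSpace Ω]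
    {μ : Measure Ω} [IsProbabilityMeasure μ] {E : ι → Set Ω}
    (hE : ∀ k, MeasurableSet (E k)) (hindep : iIndepSet E μ) {q t : ℝ} (hq : 0 ≤ q)
    (hEq : ∀ k, μ.real (E k) ≤ q) (ht : 0 < t) :
    μ.real {ω | Fintype.card ι * q + t ≤ (∑ k, (E k).indicator fun _ => (1 : ℝ)) ω} ≤
      Real.exp (-(t ^ 2 / (2 * (Fintype.card ι * q) + t))) := by
  set m : ℝ := Fintype.card ι * q with hm
  have hm0 : 0 ≤ m := by positivity
  have hd : 0 < 2 * m + t := by positivity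
  set s : ℝ := 2 * t / (2 * m + t) with hs
  have hs0 : 0 ≤ s := by positivity
  have hmeas : ∀ k, Measurable ((E k).indicator fun _ => (1 : ℝ)) := fun k =>
    measurable_const.indicator (hE k)
  have hInd : iIndepFun (fun k => (E k).indicator fun _ => (1 : ℝ)) μ :=
    hindep.iIndepFun_indicator
  have hint : ∀ k, Integrable (fun ω => Real.exp (s * (E k).indicator (fun _ => (1 : ℝ)) ω)) μ :=
    fun k => integrable_exp_mul_of_mem_Icc (a := 0) (b := 1) (hmeas k).aemeasurable <|
      ae_of_all _ fun ω => by by_cases h : ω ∈ E k <;> simp [h]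
  have hmgf : mgf (∑ k, (E k).indicator fun _ => (1 : ℝ)) μ s ≤
      Real.exp (m * (Real.exp s - 1)) := by
    rw [hInd.mgf_sum hmeas]
    calc ∏ k, mgf ((E k).indicator fun _ => (1 : ℝ)) μ s
        ≤ ∏ _k : ι, Real.exp (q * (Real.exp s - 1)) :=
          Finset.prod_le_prod (fun _ _ => mgf_nonneg)
            fun k _ => mgf_indicator_one_le (hE k) (hEq k) hs0
      _ = Real.exp (m * (Real.exp s - 1)) := by
          rw [Finset.prod_const, ← Real.exp_nat_mul, Finset.card_univ, hm, mul_assoc]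
  have hpoisson : m * (Real.exp s - 1) ≤ t := by
    rcases hm0.eq_or_lt with h0 | hpos
    · rw [← h0]; linarith
    · have hlog := Real.le_log_one_add_of_nonneg (x := t / m) (by positivity)
      have hse : 2 * (t / m) / (t / m + 2) = s := by
        rw [hs]; field_simp; ring
      rw [hse, Real.le_log_iff_exp_le (by positivity)] at hlog
      calc m * (Real.exp s - 1) ≤ m * (t / m) := by gcongr; linarith
        _ = t := by field_simp
  calc _ ≤ Real.exp (-s * (m + t)) * mgf (∑ k, (E k).indicator fun _ => (1 : ℝ)) μ s :=
        measure_ge_le_exp_mul_mgf _ hs0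
          (hInd.integrable_exp_mul_sum hmeas fun k _ => hint k)
    _ ≤ Real.exp (-s * (m + t)) * Real.exp t := by
        gcongr
        exact hmgf.trans (Real.exp_le_exp.2 hpoisson)
    _ = Real.exp (-(t ^ 2 / (2 * m + t))) := by
        rw [← Real.exp_add, hs]
        congr 1
        field_simp
        ring

/-- for `{0,1}`-valued `a k, b k` with `a k ≤ b k` outside independent
events `E k` of probability at most `p_L`, with probability at least `1 − p` we have
`Σ a ≤ Σ b + δ(p)` where
`δ(p) = B·p_L + (√((log p)² − 8·B·p_L·log p) − log p)/2`. -/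
theorem sum_loss_bound_outside_bad_events
    {Ω : Type*} [MeasurableSpace Ω] (μ : Measure Ω) [IsProbabilityMeasure μ]
    (B : ℕ) (hB : 0 < B) (pL : ℝ) (hpL : pL ∈ Set.Icc (0 : ℝ) 1)
    (a b : Fin B → Ω → ℝ)
    (ha : ∀ k ω, a k ω = 0 ∨ a k ω = 1)
    (hb : ∀ k ω, b k ω = 0 ∨ b k ω = 1)
    (E : Fin B → Set Ω)
    (hEmeas : ∀ k, MeasurableSet (E k))
    (hindep : iIndepSet E μ)
    (hEprob : ∀ k, μ (E k) ≤ ENNReal.ofReal pL)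
    (hab : ∀ k, ∀ ω ∉ E k, a k ω ≤ b k ω)
    (p : ℝ) (hp : p ∈ Set.Ioo (0 : ℝ) 1) :
    (1 : ENNReal) - ENNReal.ofReal p ≤
      μ {ω | (∑ k, a k ω) ≤ (∑ k, b k ω) +
        ((B : ℝ) * pL +
          (Real.sqrt ((Real.log p) ^ 2 - 8 * B * pL * Real.log p) - Real.log p) / 2)} := by
  obtain ⟨hp0, hp1⟩ := hp
  have hlog : Real.log p < 0 := Real.log_neg hp0 hp1
  have hm0 : 0 ≤ (B : ℝ) * pL := mul_nonneg (Nat.cast_nonneg B) hpL.1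
  set r : ℝ := Real.sqrt ((Real.log p) ^ 2 - 8 * B * pL * Real.log p) with hr
  have hr2 : r ^ 2 = (Real.log p) ^ 2 - 8 * B * pL * Real.log p :=
    Real.sq_sqrt (by nlinarith [sq_nonneg (Real.log p), mul_nonneg hm0 (neg_nonneg.2 hlog.le)])
  have hr0 : 0 ≤ r := Real.sqrt_nonneg _
  set t : ℝ := (r - Real.log p) / 2 with ht
  have ht0 : 0 < t := by linarith
  have hquad : t ^ 2 / (2 * ((B : ℝ) * pL) + t) = -Real.log p := by
    rw [div_eq_iff (by positivity), ht]
    linear_combination hr2 / 4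
  set T : Set Ω := {ω | (B : ℝ) * pL + t ≤ (∑ k, (E k).indicator fun _ => (1 : ℝ)) ω} with hT
  have hTmeas : MeasurableSet T := measurableSet_le measurable_const <| by
    simpa only [Finset.sum_fn] using Finset.measurable_sum Finset.univ fun k _ => measurable_const.indicator (hEmeas k)
  have hTp : μ T ≤ ENNReal.ofReal p := by
    have h := measureReal_sum_indicator_ge_le hEmeas hindep hpL.1
      (fun k => ENNReal.toReal_le_of_le_ofReal hpL.1 (hEprob k)) ht0
    rw [Fintype.card_fin, hquad, neg_neg, Real.exp_log hp0] at h
    exact (ENNReal.le_ofReal_iff_toReal_le (measure_ne_top μ T) hp0.le).2 h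
  calc (1 : ENNReal) - ENNReal.ofReal p ≤ 1 - μ T := tsub_le_tsub_left hTp 1
    _ = μ Tᶜ := (prob_compl_eq_one_sub hTmeas).symm
    _ ≤ _ := measure_mono fun ω hω => by
      have hlt : ∑ k, (E k).indicator (fun _ => (1 : ℝ)) ω < (B : ℝ) * pL + t := by
        simpa [hT, Finset.sum_apply] using hω
      have hle : ∑ k, a k ω ≤ ∑ k, (b k ω + (E k).indicator (fun _ => (1 : ℝ)) ω) := by
        refine Finset.sum_le_sum fun k _ => ?_
        by_cases h : ω ∈ E k
        · rw [Set.indicator_of_mem h]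
          rcases ha k ω with h1 | h1 <;> rcases hb k ω with h2 | h2 <;> rw [h1, h2] <;> norm_num
        · rw [Set.indicator_of_notMem h, add_zero]
          exact hab k ω h
      rw [Finset.sum_add_distrib] at hle
      exact hle.trans (by gcongr)
end

section
/- Let (Ω, μ) be a probability space and β̄ : Ω → B. Suppose: (i) the events E i (i ∈ I⁺) are measurable, independent as a family, and satisfy μ (E i) ≤ p_L; (ii) for every i ∈ I⁺ and every ω ∉ E i, ℓ01⁺ (β̄ ω) (O (β̄ ω) (x i)) ≤ ℓ01⁺ (β̄ ω) (O_L ω (β̄ ω) (x i)); (iii) for every i ∈ I⁺ and every ω, O_L ω (β̄ ω) (x i) ∈ insert (x i) (N ω i); (iv) for every ω, β̄ ω is a global minimizer of β ↦ L_R(ω)(β). Let B_card = |I⁺| and, for p ∈ (0,1), δ(p) = B_card·p_L + (Real.sqrt ((Real.log p)^2 − 8·B_card·p_L·(Real.log p)) − Real.log p)/2. Then μ {ω : for all β, (⨅ β', L_A01(β')) ≤ L_R(ω)(β) + δ(p)} ≥ 1 − p. -/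
open MeasureTheory ProbabilityTheory

/-- The moment generating function of the indicator of an event. -/
lemma mgf_indicator_one {Ω : Type*} [MeasurableSpace Ω] {μ : Measure Ω} [IsProbabilityMeasure μ]
    {s : Set Ω} (hs : MeasurableSet s) (a : ℝ) :
    mgf (s.indicator fun _ => (1 : ℝ)) μ a = 1 + μ.real s * (Real.exp a - 1) := by
  have h : (fun ω => Real.exp (a * s.indicator (fun _ => (1 : ℝ)) ω)) =
      fun ω => 1 + s.indicator (fun _ => Real.exp a - 1) ω := by
    funext ω
    by_cases hω : ω ∈ s <;> simp [hω]
  rw [mgf, h, integral_add (integrable_const _) ((integrable_const _).indicator hs),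
    integral_indicator_const _ hs]
  simp

/-- Chernoff's bound for the number of events that occur in a finite independent family. -/
lemma measureReal_ge_sum_indicator_le {Ω ι : Type*} [MeasurableSpace Ω] {μ : Measure Ω}
    [IsProbabilityMeasure μ] [Fintype ι] {E : ι → Set Ω} (hE : ∀ i, MeasurableSet (E i))
    (hindep : iIndepSet E μ) {q : ℝ} (hq : ∀ i, μ.real (E i) ≤ q) (c : ℝ) {a : ℝ} (ha : 0 ≤ a) :
    μ.real {ω | c ≤ ∑ i, (E i).indicator (fun _ => (1 : ℝ)) ω} ≤
      Real.exp (Fintype.card ι * q * (Real.exp a - 1) - a * c) := by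
  have hX (i : ι) : Measurable ((E i).indicator fun _ => (1 : ℝ)) :=
    measurable_const.indicator (hE i)
  have hexp : 0 ≤ Real.exp a - 1 := by linarith [Real.one_le_exp ha]
  have hfactor (i : ι) :
      mgf ((E i).indicator fun _ => (1 : ℝ)) μ a ≤ Real.exp (q * (Real.exp a - 1)) := by
    rw [mgf_indicator_one (hE i)]
    have := mul_le_mul_of_nonneg_right (hq i) hexp
    linarith [Real.add_one_le_exp (q * (Real.exp a - 1))]
  have hsum : Measurable (∑ i, (E i).indicator fun _ => (1 : ℝ)) := by
    rw [Finset.sum_fn]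
    exact Finset.measurable_fun_sum _ fun i _ => hX i
  have hint : Integrable
      (fun ω => Real.exp (a * (∑ i, (E i).indicator fun _ => (1 : ℝ)) ω)) μ := by
    refine Integrable.of_bound (by fun_prop) (Real.exp (a * Fintype.card ι))
      (ae_of_all _ fun ω => ?_)
    rw [Real.norm_eq_abs, Real.abs_exp, Finset.sum_apply]
    gcongr
    calc ∑ i, (E i).indicator (fun _ => (1 : ℝ)) ω ≤ ∑ _i : ι, (1 : ℝ) :=
          Finset.sum_le_sum fun i _ => Set.indicator_le_self' (by simp) ω
      _ = Fintype.card ι := by simp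
  have hchernoff := measure_ge_le_exp_mul_mgf c ha hint
  rw [hindep.iIndepFun_indicator.mgf_sum hX] at hchernoff
  simp only [Finset.sum_apply] at hchernoff
  calc _ ≤ _ := hchernoff
    _ ≤ Real.exp (-a * c) * ∏ _i : ι, Real.exp (q * (Real.exp a - 1)) := by
      gcongr with i
      · exact fun _ _ => mgf_nonneg
      · exact hfactor i
    _ = _ := by
      rw [Finset.prod_const, Finset.card_univ, ← Real.exp_nat_mul, ← Real.exp_add]
      ring_nf

/-- The root `t` of `t ^ 2 = l * (2 * m + t)` admits a Chernoff exponent of at most `-l`. -/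
lemma exists_chernoff_exponent_le {m t l : ℝ} (hm : 0 ≤ m) (ht : 0 < t)
    (h : t ^ 2 = l * (2 * m + t)) :
    ∃ a, 0 ≤ a ∧ m * (Real.exp a - 1) - a * (m + t) ≤ -l := by
  rcases hm.eq_or_lt with rfl | hm
  · exact ⟨1, zero_le_one, by nlinarith⟩
  refine ⟨Real.log (1 + t / m), Real.log_nonneg (by linarith [div_pos ht hm]), ?_⟩
  rw [Real.exp_log (by positivity)]
  have hlog := Real.le_log_one_add_of_nonneg (div_pos ht hm).le
  have hrw : 2 * (t / m) / (t / m + 2) * (m + t) = t + l := by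
    have hl : l = t ^ 2 / (2 * m + t) := by field_simp; linarith
    rw [hl]
    field_simp
    ring
  have hmul := mul_le_mul_of_nonneg_right hlog (add_pos hm ht).le
  have : m * (1 + t / m - 1) = t := by field_simp; ring
  linarith

/-- With probability at least `1 - p`, the number of events that occur in a finite independent
family of events of probability at most `q` exceeds its mean bound by at most the root of the
quadratic equation coming from the multiplicative Chernoff bound. -/
lemma one_sub_le_measure_sum_indicator_le {Ω ι : Type*} [MeasurableSpace Ω] {μ : Measure Ω}
    [IsProbabilityMeasure μ] [Fintype ι] {E : ι → Set Ω} (hE : ∀ i, MeasurableSet (E i))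
    (hindep : iIndepSet E μ) {q : ℝ} (hq0 : 0 ≤ q) (hq : ∀ i, μ.real (E i) ≤ q)
    {p : ℝ} (hp : p ∈ Set.Ioo (0 : ℝ) 1) :
    1 - ENNReal.ofReal p ≤ μ {ω | ∑ i, (E i).indicator (fun _ => (1 : ℝ)) ω ≤
      Fintype.card ι * q + (Real.sqrt ((Real.log p) ^ 2 - 8 * Fintype.card ι * q * Real.log p)
        - Real.log p) / 2} := by
  have hlog : Real.log p < 0 := Real.log_neg hp.1 hp.2
  have hm : 0 ≤ Fintype.card ι * q := by positivity
  set s := Real.sqrt ((Real.log p) ^ 2 - 8 * Fintype.card ι * q * Real.log p)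
  have hs : s ^ 2 = (Real.log p) ^ 2 - 8 * Fintype.card ι * q * Real.log p :=
    Real.sq_sqrt (by nlinarith)
  have hs0 : 0 ≤ s := Real.sqrt_nonneg _
  obtain ⟨a, ha, hexp⟩ := exists_chernoff_exponent_le (t := (s - Real.log p) / 2)
    (l := -Real.log p) hm (by linarith) (by linarith)
  set c := Fintype.card ι * q + (s - Real.log p) / 2
  have hmeas : Measurable fun ω => ∑ i, (E i).indicator (fun _ => (1 : ℝ)) ω :=
    Finset.measurable_fun_sum _ fun i _ => measurable_const.indicator (hE i)
  have htail : μ {ω | c ≤ ∑ i, (E i).indicator (fun _ => (1 : ℝ)) ω} ≤ ENNReal.ofReal p := by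
    rw [← ofReal_measureReal]
    refine ENNReal.ofReal_le_ofReal
      ((measureReal_ge_sum_indicator_le hE hindep hq c ha).trans ?_)
    calc _ ≤ Real.exp (Real.log p) := Real.exp_le_exp.mpr (by linarith)
      _ = p := Real.exp_log hp.1
  calc 1 - ENNReal.ofReal p
      ≤ 1 - μ {ω | c ≤ ∑ i, (E i).indicator (fun _ => (1 : ℝ)) ω} := tsub_le_tsub_left htail _
    _ = μ {ω | c ≤ ∑ i, (E i).indicator (fun _ => (1 : ℝ)) ω}ᶜ :=
      (prob_compl_eq_one_sub (measurableSet_le measurable_const hmeas)).symm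
    _ ≤ _ := measure_mono fun ω hω => (not_le.mp (Set.notMem_ofPred_iff.mp hω)).le

/-- Proposition 4.2: retraining with an approximate (random) evasion
oracle `O_L` minimizes, with probability at least `1 − p`, an upper bound
`L_R(ω)(β) + δ(p)` on the optimal 0/1 adversarial risk `⨅ β', L_A01 β'`. -/
theorem retraining_with_approximate_oracle_bound
    {B X I Ω : Type*} [Fintype I] [DecidableEq I] [DecidableEq X]
    [MeasurableSpace Ω] (μ : Measure Ω) [IsProbabilityMeasure μ]
    (x : I → X) (Iminus Iplus : Finset I)
    (hpart : Iminus ∪ Iplus = Finset.univ) (hdisj : Disjoint Iminus Iplus)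
    -- 0/1 losses, taking values in {0,1}
    (ℓ01neg ℓ01pos : B → X → ℝ)
    (hℓ01neg : ∀ β z, ℓ01neg β z = 0 ∨ ℓ01neg β z = 1)
    (hℓ01pos : ∀ β z, ℓ01pos β z = 0 ∨ ℓ01pos β z = 1)
    -- surrogate losses dominating the 0/1 losses
    (ℓneg ℓpos : B → X → ℝ)
    (hℓneg : ∀ β z, ℓ01neg β z ≤ ℓneg β z) (hℓneg0 : ∀ β z, 0 ≤ ℓ01neg β z)
    (hℓpos : ∀ β z, ℓ01pos β z ≤ ℓpos β z) (hℓpos0 : ∀ β z, 0 ≤ ℓ01pos β z)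
    (r : B → ℝ) (hr : ∀ β, 0 ≤ r β)
    -- exact oracle, random approximate oracle, random retraining sets
    (O : B → X → X) (OL : Ω → B → X → X) (N : Ω → I → Finset X)
    (pL : ℝ) (hpL : pL ∈ Set.Icc (0 : ℝ) 1)
    -- the risks
    (LA01 : B → ℝ) (LR : Ω → B → ℝ)
    (hLA01 : ∀ β, LA01 β =
      (∑ i ∈ Iminus, ℓ01neg β (x i)) + (∑ i ∈ Iplus, ℓ01pos β (O β (x i))) + r β)
    (hLR : ∀ ω β, LR ω β =
      (∑ i ∈ Iminus, ℓneg β (x i)) +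
        (∑ i ∈ Iplus, ∑ x' ∈ insert (x i) (N ω i), ℓpos β x') + r β)
    (βbar : Ω → B)
    -- (i) bad events: approximate oracle suboptimal
    (E : I → Set Ω)
    (hEmeas : ∀ i ∈ Iplus, MeasurableSet (E i))
    (hindep : iIndepSet (fun i : {i // i ∈ Iplus} => E i.1) μ)
    (hEprob : ∀ i ∈ Iplus, μ (E i) ≤ ENNReal.ofReal pL)
    -- (ii) outside the bad event the approximate oracle over-estimates the 0/1 loss
    (hdom : ∀ i ∈ Iplus, ∀ ω, ω ∉ E i →
      ℓ01pos (βbar ω) (O (βbar ω) (x i)) ≤ ℓ01pos (βbar ω) (OL ω (βbar ω) (x i)))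
    -- (iii) termination: approximate-oracle outputs lie in the retraining sets
    (hterm : ∀ i ∈ Iplus, ∀ ω, OL ω (βbar ω) (x i) ∈ insert (x i) (N ω i))
    -- (iv) β̄ ω minimizes the retrained risk
    (hmin : ∀ ω β, LR ω (βbar ω) ≤ LR ω β)
    (p : ℝ) (hp : p ∈ Set.Ioo (0 : ℝ) 1) :
    (1 : ENNReal) - ENNReal.ofReal p ≤
      μ {ω | ∀ β, (⨅ β' : B, LA01 β') ≤ LR ω β +
        ((Iplus.card : ℝ) * pL +
          (Real.sqrt ((Real.log p) ^ 2 - 8 * Iplus.card * pL * Real.log p)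
            - Real.log p) / 2)} := by
  have hq (i : {i // i ∈ Iplus}) : μ.real (E i.1) ≤ pL :=
    ENNReal.toReal_le_of_le_ofReal hpL.1 (hEprob i.1 i.2)
  have hconc := one_sub_le_measure_sum_indicator_le
    (fun i : {i // i ∈ Iplus} => hEmeas i.1 i.2) hindep hpL.1 hq hp
  rw [Fintype.card_coe] at hconc
  refine hconc.trans (measure_mono fun ω hω β => ?_)
  rw [Set.mem_ofPred_eq,
    Finset.sum_coe_sort Iplus fun i => (E i).indicator (fun _ => (1 : ℝ)) ω] at hω
  have hbdd : BddBelow (Set.range LA01) := by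
    refine ⟨0, Set.forall_mem_range.mpr fun β => ?_⟩
    rw [hLA01]
    exact add_nonneg (add_nonneg (Finset.sum_nonneg fun i _ => hℓneg0 _ _)
      (Finset.sum_nonneg fun i _ => hℓpos0 _ _)) (hr β)
  have hneg : ∑ i ∈ Iminus, ℓ01neg (βbar ω) (x i) ≤ ∑ i ∈ Iminus, ℓneg (βbar ω) (x i) :=
    Finset.sum_le_sum fun i _ => hℓneg _ _
  have hℓpos_nonneg (z : X) : 0 ≤ ℓpos (βbar ω) z := (hℓpos0 _ z).trans (hℓpos _ z)
  have hpos : ∑ i ∈ Iplus, ℓ01pos (βbar ω) (O (βbar ω) (x i)) ≤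
      (∑ i ∈ Iplus, ∑ x' ∈ insert (x i) (N ω i), ℓpos (βbar ω) x') +
        ∑ i ∈ Iplus, (E i).indicator (fun _ => (1 : ℝ)) ω := by
    rw [← Finset.sum_add_distrib]
    refine Finset.sum_le_sum fun i hi => ?_
    by_cases hω : ω ∈ E i
    · rw [Set.indicator_of_mem hω]
      have hle : ℓ01pos (βbar ω) (O (βbar ω) (x i)) ≤ 1 := by
        rcases hℓ01pos (βbar ω) (O (βbar ω) (x i)) with h | h <;> simp [h]
      exact hle.trans (le_add_of_nonneg_left (Finset.sum_nonneg fun z _ => hℓpos_nonneg z))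
    · rw [Set.indicator_of_notMem hω, add_zero]
      exact (hdom i hi ω hω).trans ((hℓpos _ _).trans
        (Finset.single_le_sum (fun z _ => hℓpos_nonneg z) (hterm i hi ω)))
  have hinf := ciInf_le hbdd (βbar ω)
  have hβ := hmin ω β
  rw [hLA01] at hinf
  rw [hLR ω (βbar ω)] at hβ
  linarith
end

section
/- Suppose β̄ is a global minimizer of the multi-class retrained empirical risk L_R^M (i.e., L_R^M(β̄) ≤ L_R^M(β) for all β ∈ B), and for every malicious index i ∈ I_M, O β̄ (x i) ∈ insert (x i) (N i). Then for every β ∈ B, L_A^M(β̄) ≤ L_R^M(β); in particular, the infimum over all β of the multi-class adversarial risk L_A^M(β) is at most L_R^M(β) for every β. -/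
/-- multi-class version of the retraining bound. If `β̄` globally minimizes
the multi-class retrained risk and the termination condition holds at `β̄`, then the
multi-class adversarial risk at `β̄` is at most `LR β` for every `β`, and so is its
infimum over all parameters. -/
theorem multiclass_retraining_upper_bounds_adversarial_risk
    {B X Y I : Type*} [Fintype I] [DecidableEq I] [DecidableEq X]
    (x : I → X) (y : I → Y) (M : Set Y)
    (IM : Finset I) (hIM : ∀ i, i ∈ IM ↔ y i ∈ M)
    (ℓ : B → X → Y → ℝ) (hℓ : ∀ β z y', 0 ≤ ℓ β z y')
    (r : B → ℝ) (hr : ∀ β, 0 ≤ r β)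
    (O : B → X → X) (N : I → Finset X)
    (LA LR : B → ℝ)
    (hLA : ∀ β, LA β =
      (∑ i ∈ IMᶜ, ℓ β (x i) (y i)) + (∑ i ∈ IM, ℓ β (O β (x i)) (y i)) + r β)
    (hLR : ∀ β, LR β =
      (∑ i ∈ IMᶜ, ℓ β (x i) (y i)) +
        (∑ i ∈ IM, ∑ x' ∈ insert (x i) (N i), ℓ β x' (y i)) + r β)
    (βbar : B)
    (hmin : ∀ β, LR βbar ≤ LR β)
    (hterm : ∀ i ∈ IM, O βbar (x i) ∈ insert (x i) (N i)) :
    (∀ β, LA βbar ≤ LR β) ∧ (∀ β, (⨅ β' : B, LA β') ≤ LR β) := by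
  have key : ∀ β, LA βbar ≤ LR β := fun β => by
    refine le_trans ?_ (hmin β)
    rw [hLA, hLR]
    gcongr with i hi
    exact Finset.single_le_sum (f := fun x' => ℓ βbar x' (y i))
      (fun z _ => hℓ βbar z (y i)) (hterm i hi)
  have hbdd : BddBelow (Set.range LA) := by
    refine ⟨0, ?_⟩
    rintro _ ⟨β, rfl⟩
    rw [hLA]
    exact add_nonneg (add_nonneg (Finset.sum_nonneg fun _ _ => hℓ _ _ _)
      (Finset.sum_nonneg fun _ _ => hℓ _ _ _)) (hr β)
  exact ⟨key, fun β => (ciInf_le hbdd βbar).trans (key β)⟩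
end
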